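/- arXiv:1401.2282 — 8 statements merged into one kernel-verified Lean document; each statement's English description precedes it below -/
import Mathlib

section
/- Let α, β, k, μ > 0 and γ ≥ 0. The function F_T(t) = 1 − [(t/α)^β/μ + 1]^{−k} exp(−γ (t/α)^β) is differentiable at every t > 0 with derivative F_T′(t) = f_T(t) = (β/α)(t/α)^{β−1} [(t/α)^β/μ + 1]^{−k} { γ + k [ (t/α)^β + μ ]^{−1} } exp(−γ (t/α)^β). -/
/-- The field failure time c.d.f. of the gamma frailty model is differentiable
at every `t > 0`, with derivative equal to the claimed field p.d.f. -/
theorem gamma_frailty_cdf_hasDerivAt (α β k μ γ : ℝ)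
    (hα : 0 < α) (hβ : 0 < β) (hk : 0 < k) (hμ : 0 < μ) (hγ : 0 ≤ γ)
    (t : ℝ) (ht : 0 < t) :
    HasDerivAt
      (fun s : ℝ => 1 - ((s / α) ^ β / μ + 1) ^ (-k) * Real.exp (-(γ * (s / α) ^ β)))
      (β / α * (t / α) ^ (β - 1) * ((t / α) ^ β / μ + 1) ^ (-k) *
        (γ + k * ((t / α) ^ β + μ)⁻¹) * Real.exp (-(γ * (t / α) ^ β))) t := by
  have hx : 0 < (t / α) ^ β := Real.rpow_pos_of_pos (div_pos ht hα) β
  have hb : 0 < (t / α) ^ β / μ + 1 := by positivity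
  have hpow : HasDerivAt (fun s : ℝ => (s / α) ^ β) (1 / α * β * (t / α) ^ (β - 1)) t :=
    ((hasDerivAt_id t).div_const α).rpow_const (Or.inl (div_pos ht hα).ne')
  have hfrailty := ((hpow.div_const μ).add_const 1).rpow_const (p := -k) (Or.inl hb.ne')
  have hexp := (hpow.const_mul γ).neg.exp
  refine ((hfrailty.mul hexp).const_sub 1).congr_deriv ?_
  simp only [Pi.neg_apply, Real.rpow_sub_one hb.ne']
  generalize (t / α) ^ β = x at *
  generalize (x / μ + 1) ^ (-k) = y
  have hxμ : x + μ ≠ 0 := (add_pos hx hμ).ne'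
  have hdiv : x / μ + 1 = (x + μ) / μ := by field_simp
  rw [hdiv]
  field_simp
  ring
end

section
/- Let α, β, k, μ > 0 and γ ≥ 0, and let h_T(t) = (γβ/α)(t/α)^{β−1} + k β t^{β−1}/(t^β + μ α^β) for t > 0. Then h_T is differentiable on (0, ∞) with h_T′(t) = r(t^β) · β t^{β−2}/(t^β + μ α^β)², where r(x) = (β−1)γ α^{−β} x² + (2βγμ − 2γμ − k) x + μ α^β (μγ + k)(β−1). In particular, for every t > 0 the sign of h_T′(t) equals the sign of r(t^β). -/
/-- The quadratic governing the sign of the derivative of the field hazard rate. -/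
noncomputable def rQuad (α β k μ γ : ℝ) (x : ℝ) : ℝ :=
  (β - 1) * γ * α ^ (-β) * x ^ 2 + (2 * β * γ * μ - 2 * γ * μ - k) * x +
    μ * α ^ β * (μ * γ + k) * (β - 1)

theorem Real.sign_mul_of_pos_right (a : ℝ) {b : ℝ} (hb : 0 < b) :
    Real.sign (a * b) = Real.sign a := by
  rcases lt_trichotomy a 0 with ha | rfl | ha
  · rw [Real.sign_of_neg ha, Real.sign_of_neg (mul_neg_of_neg_of_pos ha hb)]
  · rw [zero_mul]
  · rw [Real.sign_of_pos ha, Real.sign_of_pos (mul_pos ha hb)]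

/-- The field hazard rate of the gamma frailty model is differentiable on
`(0, ∞)` with derivative `r(t^β) · β t^(β-2) / (t^β + μ α^β)²`; in particular, the sign of the
derivative at `t` is the sign of `r(t^β)`. -/
theorem gamma_frailty_hazard_deriv (α β k μ γ : ℝ)
    (hα : 0 < α) (hβ : 0 < β) (hk : 0 < k) (hμ : 0 < μ) (hγ : 0 ≤ γ) :
    ∀ t : ℝ, 0 < t →
      HasDerivAt
        (fun s : ℝ => γ * β / α * (s / α) ^ (β - 1) +
          k * β * s ^ (β - 1) / (s ^ β + μ * α ^ β))
        (rQuad α β k μ γ (t ^ β) * (β * t ^ (β - 2) / (t ^ β + μ * α ^ β) ^ 2)) t ∧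
      Real.sign
        (deriv (fun s : ℝ => γ * β / α * (s / α) ^ (β - 1) +
          k * β * s ^ (β - 1) / (s ^ β + μ * α ^ β)) t)
        = Real.sign (rQuad α β k μ γ (t ^ β)) := by
  intro t ht
  have hx : 0 < t ^ β := Real.rpow_pos_of_pos ht β
  have ha : 0 < α ^ β := Real.rpow_pos_of_pos hα β
  have hD : 0 < t ^ β + μ * α ^ β := by positivity
  have hfactor : 0 < β * t ^ (β - 2) / (t ^ β + μ * α ^ β) ^ 2 := by positivity
  have hderiv : HasDerivAt
      (fun s : ℝ => γ * β / α * (s / α) ^ (β - 1) +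
        k * β * s ^ (β - 1) / (s ^ β + μ * α ^ β))
      (rQuad α β k μ γ (t ^ β) * (β * t ^ (β - 2) / (t ^ β + μ * α ^ β) ^ 2)) t := by
    have hbaseline : HasDerivAt (fun s : ℝ => γ * β / α * (s / α) ^ (β - 1))
        (γ * β / α * (1 / α * (β - 1) * (t / α) ^ (β - 1 - 1))) t :=
      (((hasDerivAt_id t).div_const α).rpow_const
        (Or.inl (div_pos ht hα).ne')).const_mul _
    have hfrailty : HasDerivAt (fun s : ℝ => k * β * s ^ (β - 1) / (s ^ β + μ * α ^ β))
        ((k * β * ((β - 1) * t ^ (β - 1 - 1)) * (t ^ β + μ * α ^ β) -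
          k * β * t ^ (β - 1) * (β * t ^ (β - 1))) / (t ^ β + μ * α ^ β) ^ 2) t :=
      ((Real.hasDerivAt_rpow_const (Or.inl ht.ne')).const_mul (k * β)).div
        ((Real.hasDerivAt_rpow_const (Or.inl ht.ne')).add_const _) hD.ne'
    refine (hbaseline.add hfrailty).congr_deriv ?_
    have hexp : β - 1 - 1 = β - 2 := by ring
    have hpred : t ^ (β - 1) = t ^ β / t := Real.rpow_sub_one ht.ne' β
    have hpred₂ (u : ℝ) (hu : 0 < u) : u ^ (β - 2) = u ^ β / u ^ 2 := by
      rw [Real.rpow_sub hu, Real.rpow_two]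
    rw [rQuad, hexp, Real.div_rpow ht.le hα.le, hpred, hpred₂ t ht, hpred₂ α hα,
      Real.rpow_neg hα.le]
    field_simp
    ring
  exact ⟨hderiv, by rw [hderiv.deriv, Real.sign_mul_of_pos_right _ hfactor]⟩
end

section
/- Let α, k, μ > 0, γ ≥ 0, and 0 < β < 1. Then the field hazard rate h_T(t) = (γβ/α)(t/α)^{β−1} + k β t^{β−1}/(t^β + μ α^β) is strictly decreasing on (0, ∞), with lim_{t→0+} h_T(t) = ∞ and lim_{t→∞} h_T(t) = 0. -/
/-- **Case 1, `β < 1`.** For `0 < β < 1`, the field hazard rate of the gamma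
frailty model is strictly decreasing on `(0, ∞)`, tends to `∞` as `t → 0⁺` and to `0` as
`t → ∞`. -/
theorem gamma_frailty_hazard_decreasing_of_beta_lt_one (α β k μ γ : ℝ)
    (hα : 0 < α) (hk : 0 < k) (hμ : 0 < μ) (hγ : 0 ≤ γ) (hβ0 : 0 < β) (hβ1 : β < 1) :
    StrictAntiOn
      (fun t : ℝ => γ * β / α * (t / α) ^ (β - 1) +
        k * β * t ^ (β - 1) / (t ^ β + μ * α ^ β)) (Set.Ioi 0) ∧
    Filter.Tendsto
      (fun t : ℝ => γ * β / α * (t / α) ^ (β - 1) +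
        k * β * t ^ (β - 1) / (t ^ β + μ * α ^ β))
      (nhdsWithin 0 (Set.Ioi 0)) Filter.atTop ∧
    Filter.Tendsto
      (fun t : ℝ => γ * β / α * (t / α) ^ (β - 1) +
        k * β * t ^ (β - 1) / (t ^ β + μ * α ^ β))
      Filter.atTop (nhds 0) := by
  have hc : 0 < μ * α ^ β := mul_pos hμ (Real.rpow_pos_of_pos hα β)
  have hβ : β - 1 < 0 := by linarith
  have hkβ : 0 < k * β := mul_pos hk hβ0
  have h_top : Filter.Tendsto (fun t : ℝ => t ^ (β - 1)) Filter.atTop (nhds 0) := by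
    simpa using tendsto_rpow_neg_atTop (y := 1 - β) (by linarith)
  refine ⟨fun s hs t ht hst => ?_, ?_, ?_⟩
  · rw [Set.mem_Ioi] at hs ht
    have h_pow : t ^ (β - 1) < s ^ (β - 1) := Real.rpow_lt_rpow_of_neg hs hst hβ
    have h_base : (t / α) ^ (β - 1) ≤ (s / α) ^ (β - 1) :=
      Real.rpow_le_rpow_of_nonpos (div_pos hs hα) (by gcongr) hβ.le
    have h_den : s ^ β ≤ t ^ β := Real.rpow_le_rpow hs.le hst.le hβ0.le
    refine add_lt_add_of_le_of_lt (mul_le_mul_of_nonneg_left h_base (by positivity)) ?_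
    exact div_lt_div₀ (mul_lt_mul_of_pos_left h_pow hkβ) (by linarith) (by positivity)
      (by positivity)
  · have h_num : Filter.Tendsto (fun t : ℝ => k * β * t ^ (β - 1))
        (nhdsWithin 0 (Set.Ioi 0)) Filter.atTop :=
      (tendsto_rpow_neg_nhdsGT_zero hβ).const_mul_atTop hkβ
    have h_den : Filter.Tendsto (fun t : ℝ => (t ^ β + μ * α ^ β)⁻¹)
        (nhdsWithin 0 (Set.Ioi 0)) (nhds (μ * α ^ β)⁻¹) := by
      have h_zero : Filter.Tendsto (fun t : ℝ => t ^ β) (nhdsWithin 0 (Set.Ioi 0)) (nhds 0) :=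
        (Filter.Tendsto.rpow_const_nhds_zero Filter.tendsto_id hβ0).mono_left nhdsWithin_le_nhds
      simpa using (h_zero.add_const (μ * α ^ β)).inv₀ (by simpa using hc.ne')
    refine Filter.tendsto_atTop_mono' _ ?_ (h_num.atTop_mul_pos (inv_pos.mpr hc) h_den)
    filter_upwards [self_mem_nhdsWithin] with t ht
    rw [Set.mem_Ioi] at ht
    rw [← div_eq_mul_inv]
    exact le_add_of_nonneg_left (by positivity)
  · have h_first : Filter.Tendsto (fun t : ℝ => γ * β / α * (t / α) ^ (β - 1))
        Filter.atTop (nhds 0) := by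
      simpa using (h_top.comp (Filter.tendsto_id.atTop_div_const hα)).const_mul (γ * β / α)
    have h_second : Filter.Tendsto (fun t : ℝ => k * β * t ^ (β - 1) / (t ^ β + μ * α ^ β))
        Filter.atTop (nhds 0) :=
      Filter.Tendsto.div_atTop (by simpa using h_top.const_mul (k * β))
        (Filter.tendsto_atTop_add_const_right _ _ (tendsto_rpow_atTop hβ0))
    simpa using h_first.add h_second
end

section
/- Let α, k, μ > 0, γ > 0, β > 1, and suppose 4γμβ(β−1) < k. Then the field hazard rate h_T(t) = (γβ/α)(t/α)^{β−1} + k β t^{β−1}/(t^β + μ α^β) has an N-shape: there exist 0 < t₁ < t₂ such that h_T is strictly increasing on (0, t₁], strictly decreasing on [t₁, t₂], and strictly increasing on [t₂, ∞). -/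
theorem hasDerivAt_frailty_hazard {β k μ γ s : ℝ} (hμ : 0 < μ) (hs : 0 < s) :
    HasDerivAt (fun s : ℝ => γ * s ^ (β - 1) + k * s ^ (β - 1) / (s ^ β + μ))
      (s ^ (β - 2) / (s ^ β + μ) ^ 2 *
        (γ * (β - 1) * (s ^ β + μ) ^ 2 - k * (s ^ β + μ) + k * β * μ)) s := by
  have hpow : 0 < s ^ β := Real.rpow_pos_of_pos hs β
  have hden : s ^ β + μ ≠ 0 := by positivity
  have h₁ := Real.hasDerivAt_rpow_const (x := s) (p := β - 1) (Or.inl hs.ne')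
  have h₂ := (Real.hasDerivAt_rpow_const (x := s) (p := β) (Or.inl hs.ne')).add_const μ
  refine ((h₁.const_mul γ).add ((h₁.const_mul k).div h₂ hden)).congr_deriv ?_
  have e₁ : s ^ (β - 1) = s ^ (β - 2) * s := by
    rw [← Real.rpow_add_one hs.ne']; ring_nf
  have e₂ : s ^ β = s ^ (β - 2) * s * s := by
    rw [← Real.rpow_add_one hs.ne', ← Real.rpow_add_one hs.ne']; ring_nf
  have e₃ : β - 1 - 1 = β - 2 := by ring
  rw [e₃, e₁]
  rw [e₂] at hden ⊢
  field_simp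
  ring

theorem exists_roots_frailty_quadratic {β k μ γ : ℝ}
    (hk : 0 < k) (hμ : 0 < μ) (hγ : 0 < γ) (hβ : 1 < β)
    (hcond : 4 * γ * μ * β * (β - 1) < k) :
    ∃ v₁ v₂ : ℝ, μ < v₁ ∧ v₁ < v₂ ∧
      ∀ v, γ * (β - 1) * v ^ 2 - k * v + k * β * μ = γ * (β - 1) * ((v - v₁) * (v - v₂)) := by
  have ha : 0 < γ * (β - 1) := mul_pos hγ (by linarith)
  set a := γ * (β - 1) with ha_def
  have hc : 4 * a * β * μ < k := by rw [ha_def]; linarith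
  have hdisc : 0 < k ^ 2 - 4 * a * (k * β * μ) := by nlinarith
  set d := √(k ^ 2 - 4 * a * (k * β * μ)) with hd_def
  have hd : 0 < d := Real.sqrt_pos.2 hdisc
  have hd2 : d ^ 2 = k ^ 2 - 4 * a * (k * β * μ) := Real.sq_sqrt hdisc.le
  have haμ : 0 < a * μ := mul_pos ha hμ
  have h_lt : 2 * a * μ < k := by nlinarith
  refine ⟨(k - d) / (2 * a), (k + d) / (2 * a), ?_, ?_, fun v => ?_⟩
  · rw [lt_div_iff₀ (by positivity)]
    have : d < k - 2 * a * μ := by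
      apply lt_of_pow_lt_pow_left₀ 2 (by linarith)
      rw [hd2]
      nlinarith [mul_pos (mul_pos haμ hk) (sub_pos.2 hβ), mul_pos haμ haμ]
    linarith
  · gcongr
    linarith
  · field_simp
    linear_combination hd2

open Set in
theorem frailty_hazard_N_shape_of_scale_one {β k μ γ : ℝ}
    (hk : 0 < k) (hμ : 0 < μ) (hγ : 0 < γ) (hβ : 1 < β)
    (hcond : 4 * γ * μ * β * (β - 1) < k) :
    ∃ s₁ s₂ : ℝ, 0 < s₁ ∧ s₁ < s₂ ∧
      StrictMonoOn (fun s : ℝ => γ * s ^ (β - 1) + k * s ^ (β - 1) / (s ^ β + μ)) (Ioc 0 s₁) ∧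
      StrictAntiOn (fun s : ℝ => γ * s ^ (β - 1) + k * s ^ (β - 1) / (s ^ β + μ)) (Icc s₁ s₂) ∧
      StrictMonoOn (fun s : ℝ => γ * s ^ (β - 1) + k * s ^ (β - 1) / (s ^ β + μ)) (Ici s₂) := by
  obtain ⟨v₁, v₂, h₁, h₂, hfac⟩ := exists_roots_frailty_quadratic hk hμ hγ hβ hcond
  have hβ0 : 0 < β := by linarith
  have ha : 0 < γ * (β - 1) := mul_pos hγ (by linarith)
  have root : ∀ v, μ < v → ∃ s : ℝ, 0 < s ∧ s ^ β + μ = v := fun v hv =>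
    ⟨(v - μ) ^ β⁻¹, Real.rpow_pos_of_pos (by linarith) _, by
      rw [Real.rpow_inv_rpow (by linarith) hβ0.ne']; ring⟩
  obtain ⟨s₁, hs₁, rfl⟩ := root v₁ h₁
  obtain ⟨s₂, hs₂, rfl⟩ := root v₂ (h₁.trans h₂)
  have hs : s₁ < s₂ := (Real.rpow_lt_rpow_iff hs₁.le hs₂.le hβ0).1 (by linarith)
  have hderiv : ∀ s : ℝ, 0 < s → HasDerivAt
      (fun s : ℝ => γ * s ^ (β - 1) + k * s ^ (β - 1) / (s ^ β + μ))
      (s ^ (β - 2) / (s ^ β + μ) ^ 2 * (γ * (β - 1)) *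
        ((s ^ β - s₁ ^ β) * (s ^ β - s₂ ^ β))) s := fun s h =>
    (hasDerivAt_frailty_hazard hμ h).congr_deriv (by rw [hfac]; ring)
  have hpos : ∀ s : ℝ, 0 < s → 0 < s ^ (β - 2) / (s ^ β + μ) ^ 2 * (γ * (β - 1)) :=
    fun s h => by positivity
  have hcont : ∀ S : Set ℝ, (∀ s ∈ S, 0 < s) → ContinuousOn
      (fun s : ℝ => γ * s ^ (β - 1) + k * s ^ (β - 1) / (s ^ β + μ)) S :=
    fun S hS s h => (hderiv s (hS s h)).continuousAt.continuousWithinAt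
  refine ⟨s₁, s₂, hs₁, hs, ?_, ?_, ?_⟩
  · refine strictMonoOn_of_deriv_pos (convex_Ioc 0 s₁) (hcont _ fun s h => h.1) fun s h => ?_
    rw [interior_Ioc] at h
    rw [(hderiv s h.1).deriv]
    have := Real.rpow_lt_rpow h.1.le h.2 hβ0
    have := Real.rpow_lt_rpow h.1.le (h.2.trans hs) hβ0
    exact mul_pos (hpos s h.1) (mul_pos_of_neg_of_neg (by linarith) (by linarith))
  · refine strictAntiOn_of_deriv_neg (convex_Icc s₁ s₂)
      (hcont _ fun s h => hs₁.trans_le h.1) fun s h => ?_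
    rw [interior_Icc] at h
    have h0 := hs₁.trans h.1
    rw [(hderiv s h0).deriv]
    have := Real.rpow_lt_rpow hs₁.le h.1 hβ0
    have := Real.rpow_lt_rpow h0.le h.2 hβ0
    exact mul_neg_of_pos_of_neg (hpos s h0) (mul_neg_of_pos_of_neg (by linarith) (by linarith))
  · refine strictMonoOn_of_deriv_pos (convex_Ici s₂)
      (hcont _ fun s h => hs₂.trans_le h) fun s h => ?_
    rw [interior_Ici] at h
    have h0 := hs₂.trans h
    rw [(hderiv s h0).deriv]
    have := Real.rpow_lt_rpow hs₂.le h hβ0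
    have := Real.rpow_lt_rpow hs₁.le (hs.trans h) hβ0
    exact mul_pos (hpos s h0) (mul_pos (by linarith) (by linarith))

theorem hazard_eq_scale {α β k μ γ t : ℝ} (hα : 0 < α) (hμ : 0 < μ) (ht : 0 < t) :
    γ * β / α * (t / α) ^ (β - 1) + k * β * t ^ (β - 1) / (t ^ β + μ * α ^ β) =
      β / α * (γ * (t / α) ^ (β - 1) + k * (t / α) ^ (β - 1) / ((t / α) ^ β + μ)) := by
  obtain ⟨s, rfl⟩ : ∃ s, t = s * α := ⟨t / α, by field_simp⟩
  have hs : 0 < s := pos_of_mul_pos_left ht hα.le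
  rw [mul_div_cancel_right₀ _ hα.ne', Real.mul_rpow hs.le hα.le, Real.mul_rpow hs.le hα.le]
  have e : α ^ β = α ^ (β - 1) * α := by
    rw [← Real.rpow_add_one hα.ne']; ring_nf
  have hpow : 0 < s ^ β := Real.rpow_pos_of_pos hs β
  have hαpow : 0 < α ^ (β - 1) := Real.rpow_pos_of_pos hα _
  rw [e]
  have hden : s ^ β * (α ^ (β - 1) * α) + μ * (α ^ (β - 1) * α) =
      (s ^ β + μ) * (α ^ (β - 1) * α) := by ring
  rw [hden]
  field_simp


/-- **Case 2, N-shape.** If `β > 1`, `γ > 0` and `4γμβ(β−1) < k`, then the field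
hazard rate of the gamma frailty model has an N-shape: it is strictly increasing up to some
`t₁ > 0`, strictly decreasing between `t₁` and some `t₂ > t₁`, and strictly increasing
afterwards. -/
theorem gamma_frailty_hazard_N_shape (α β k μ γ : ℝ)
    (hα : 0 < α) (hk : 0 < k) (hμ : 0 < μ) (hγ : 0 < γ) (hβ : 1 < β)
    (hcond : 4 * γ * μ * β * (β - 1) < k) :
    ∃ t₁ t₂ : ℝ, 0 < t₁ ∧ t₁ < t₂ ∧
      StrictMonoOn
        (fun t : ℝ => γ * β / α * (t / α) ^ (β - 1) +
          k * β * t ^ (β - 1) / (t ^ β + μ * α ^ β)) (Set.Ioc 0 t₁) ∧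
      StrictAntiOn
        (fun t : ℝ => γ * β / α * (t / α) ^ (β - 1) +
          k * β * t ^ (β - 1) / (t ^ β + μ * α ^ β)) (Set.Icc t₁ t₂) ∧
      StrictMonoOn
        (fun t : ℝ => γ * β / α * (t / α) ^ (β - 1) +
          k * β * t ^ (β - 1) / (t ^ β + μ * α ^ β)) (Set.Ici t₂) := by
  obtain ⟨s₁, s₂, hs₁, hs, hmono₁, hanti, hmono₂⟩ :=
    frailty_hazard_N_shape_of_scale_one hk hμ hγ hβ hcond
  have hc : 0 < β / α := div_pos (by linarith) hα
  have hlow : ∀ {t}, s₁ * α ≤ t → 0 < t := fun h => (mul_pos hs₁ hα).trans_le h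
  have hs' : s₁ * α < s₂ * α := mul_lt_mul_of_pos_right hs hα
  refine ⟨s₁ * α, s₂ * α, mul_pos hs₁ hα, hs', fun x hx y hy hxy => ?_,
    fun x hx y hy hxy => ?_, fun x hx y hy hxy => ?_⟩
  · simp only [hazard_eq_scale hα hμ hx.1, hazard_eq_scale hα hμ hy.1]
    exact mul_lt_mul_of_pos_left (hmono₁ ⟨div_pos hx.1 hα, (div_le_iff₀ hα).2 hx.2⟩
      ⟨div_pos hy.1 hα, (div_le_iff₀ hα).2 hy.2⟩ (div_lt_div_of_pos_right hxy hα)) hc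
  · simp only [hazard_eq_scale hα hμ (hlow hx.1), hazard_eq_scale hα hμ (hlow hy.1)]
    exact mul_lt_mul_of_pos_left (hanti ⟨(le_div_iff₀ hα).2 hx.1, (div_le_iff₀ hα).2 hx.2⟩
      ⟨(le_div_iff₀ hα).2 hy.1, (div_le_iff₀ hα).2 hy.2⟩ (div_lt_div_of_pos_right hxy hα)) hc
  · simp only [hazard_eq_scale hα hμ (hlow (hs'.le.trans hx)),
      hazard_eq_scale hα hμ (hlow (hs'.le.trans hy))]
    exact mul_lt_mul_of_pos_left (hmono₂ (Set.mem_Ici.2 ((le_div_iff₀ hα).2 hx))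
      (Set.mem_Ici.2 ((le_div_iff₀ hα).2 hy)) (div_lt_div_of_pos_right hxy hα)) hc
end

section
/- Let α, k, μ > 0, γ > 0, β > 1, and suppose 4γμβ(β−1) > k. Then the field hazard rate h_T(t) = (γβ/α)(t/α)^{β−1} + k β t^{β−1}/(t^β + μ α^β) is strictly increasing on (0, ∞). -/
theorem strictMonoOn_rpow_mul_add_div {β k m c : ℝ} (hk : 0 < k) (hm : 0 < m) (hc : 0 < c)
    (hβ : 1 < β) (hcond : k < 4 * c * m * β * (β - 1)) :
    StrictMonoOn (fun t : ℝ => t ^ (β - 1) * (c + k / (t ^ β + m))) (Set.Ioi 0) := by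
  have hd : ∀ t : ℝ, 0 < t → HasDerivAt (fun t : ℝ => t ^ (β - 1) * (c + k / (t ^ β + m)))
      ((β - 1) * t ^ (β - 1 - 1) * (c + k / (t ^ β + m)) +
        t ^ (β - 1) * ((0 * (t ^ β + m) - k * (β * t ^ (β - 1))) / (t ^ β + m) ^ 2)) t := by
    intro t ht
    have hu : t ^ β + m ≠ 0 := by positivity
    exact (Real.hasDerivAt_rpow_const (Or.inl ht.ne')).mul
      (((hasDerivAt_const t k).div
        ((Real.hasDerivAt_rpow_const (Or.inl ht.ne')).add_const m) hu).const_add c)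
  refine strictMonoOn_of_deriv_pos (convex_Ioi 0)
    (fun t ht => (hd t ht).continuousAt.continuousWithinAt) fun t ht => ?_
  rw [interior_Ioi] at ht
  have ht : 0 < t := ht
  rw [(hd t ht).deriv]
  have h1 : t ^ (β - 1) = t ^ (β - 1 - 1) * t := by
    rw [← Real.rpow_add_one ht.ne', sub_add_cancel]
  have h2 : t ^ β = t ^ (β - 1) * t := by
    rw [← Real.rpow_add_one ht.ne', sub_add_cancel]
  have hu : 0 < t ^ β + m := by positivity
  have hquad : 0 < c * (β - 1) * (t ^ β + m) ^ 2 - k * (t ^ β + m) + k * β * m := by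
    have hcβ : 0 < 4 * (c * (β - 1)) := by
      have := sub_pos.2 hβ
      positivity
    refine pos_of_mul_pos_right ?_ hcβ.le
    nlinarith [sq_nonneg (2 * (c * (β - 1)) * (t ^ β + m) - k), mul_pos hk (sub_pos.2 hcond)]
  have key : (β - 1) * t ^ (β - 1 - 1) * (c + k / (t ^ β + m)) +
        t ^ (β - 1) * ((0 * (t ^ β + m) - k * (β * t ^ (β - 1))) / (t ^ β + m) ^ 2) =
      t ^ (β - 1 - 1) * (c * (β - 1) * (t ^ β + m) ^ 2 - k * (t ^ β + m) + k * β * m) /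
        (t ^ β + m) ^ 2 := by
    have hsq : t ^ (β - 1) * t ^ (β - 1) = t ^ (β - 1 - 1) * t ^ β := by
      rw [h2, h1]; ring
    field_simp
    linear_combination (-(k * β)) * hsq
  rw [key]
  positivity

/-- **Case 3.** If `β > 1`, `γ > 0` and `4γμβ(β−1) > k`, then the field hazard
rate of the gamma frailty model is strictly increasing on `(0, ∞)`. -/
theorem gamma_frailty_hazard_increasing (α β k μ γ : ℝ)
    (hα : 0 < α) (hk : 0 < k) (hμ : 0 < μ) (hγ : 0 < γ) (hβ : 1 < β)
    (hcond : k < 4 * γ * μ * β * (β - 1)) :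
    StrictMonoOn
      (fun t : ℝ => γ * β / α * (t / α) ^ (β - 1) +
        k * β * t ^ (β - 1) / (t ^ β + μ * α ^ β)) (Set.Ioi 0) := by
  have hA : 0 < α ^ β := by positivity
  have hAα : α ^ β = α ^ (β - 1) * α := by
    rw [← Real.rpow_add_one hα.ne', sub_add_cancel]
  have hmono := strictMonoOn_rpow_mul_add_div (c := γ / α ^ β) (m := μ * α ^ β) hk
    (by positivity) (by positivity) hβ (by
      have : 4 * (γ / α ^ β) * (μ * α ^ β) * β * (β - 1) = 4 * γ * μ * β * (β - 1) := by
        field_simp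
      rwa [this])
  have hβ0 : 0 < β := by linarith
  refine StrictMonoOn.congr
    (fun x hx y hy hxy => mul_lt_mul_of_pos_left (hmono hx hy hxy) hβ0) fun t ht => ?_
  have ht : 0 < t := ht
  have hB : 0 < α ^ (β - 1) := by positivity
  have hlin : γ * β / α * (t / α) ^ (β - 1) = β * (t ^ (β - 1) * (γ / α ^ β)) := by
    rw [Real.div_rpow ht.le hα.le, hAα]
    field_simp
  simp only [hlin]
  ring
end

section
/- Let α, k, μ > 0, γ = 0, and β > 1. Then the field hazard rate h_T(t) = k β t^{β−1}/(t^β + μ α^β) has an upside-down bathtub shape: with t* = α(μ(β−1))^{1/β}, h_T is strictly increasing on (0, t*] and strictly decreasing on [t*, ∞); moreover lim_{t→0+} h_T(t) = 0 and lim_{t→∞} h_T(t) = 0. -/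
/-- The function `t ↦ c t^(β-1) / (t^β + C)` has derivative
`c t^(β-2) ((β-1) C - t^β) / (t^β + C)^2` at every `t > 0`. -/
lemma hasDerivAt_rpow_sub_one_div_rpow_add {β c C t : ℝ} (hC : 0 < C) (ht : 0 < t) :
    HasDerivAt (fun t : ℝ => c * t ^ (β - 1) / (t ^ β + C))
      (c * t ^ (β - 2) * ((β - 1) * C - t ^ β) / (t ^ β + C) ^ 2) t := by
  have hden : t ^ β + C ≠ 0 := by positivity
  have hnum := (Real.hasDerivAt_rpow_const (p := β - 1) (Or.inl ht.ne')).const_mul c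
  have hd := (Real.hasDerivAt_rpow_const (p := β) (Or.inl ht.ne')).add_const C
  refine (hnum.div hd hden).congr_deriv ?_
  have h1 : t ^ (β - 1) = t ^ (β - 2) * t := by
    rw [← Real.rpow_add_one ht.ne']; ring_nf
  have h2 : t ^ β = t ^ (β - 2) * t * t := by
    rw [← h1, ← Real.rpow_add_one ht.ne']; ring_nf
  congr 1
  rw [show β - 1 - 1 = β - 2 by ring, h1, h2]
  ring

/-- **Case 4, upside-down bathtub.** If `γ = 0` and `β > 1`, the field hazard
rate `h_T(t) = kβ t^(β-1)/(t^β + μ α^β)` is strictly increasing on `(0, t*]` and strictly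
decreasing on `[t*, ∞)` with `t* = α (μ(β−1))^(1/β)`, and tends to `0` both as `t → 0⁺` and as
`t → ∞`. -/
theorem gamma_frailty_hazard_upside_down_bathtub (α β k μ : ℝ)
    (hα : 0 < α) (hk : 0 < k) (hμ : 0 < μ) (hβ : 1 < β) :
    StrictMonoOn
      (fun t : ℝ => k * β * t ^ (β - 1) / (t ^ β + μ * α ^ β))
      (Set.Ioc 0 (α * (μ * (β - 1)) ^ (1 / β))) ∧
    StrictAntiOn
      (fun t : ℝ => k * β * t ^ (β - 1) / (t ^ β + μ * α ^ β))
      (Set.Ici (α * (μ * (β - 1)) ^ (1 / β))) ∧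
    Filter.Tendsto
      (fun t : ℝ => k * β * t ^ (β - 1) / (t ^ β + μ * α ^ β))
      (nhdsWithin 0 (Set.Ioi 0)) (nhds 0) ∧
    Filter.Tendsto
      (fun t : ℝ => k * β * t ^ (β - 1) / (t ^ β + μ * α ^ β))
      Filter.atTop (nhds 0) := by
  have hc : 0 < k * β := by positivity
  have hβ' : 0 < β - 1 := by linarith
  have hC : 0 < μ * α ^ β := by positivity
  have hs : 0 < α * (μ * (β - 1)) ^ (1 / β) := by positivity
  have hpow : (α * (μ * (β - 1)) ^ (1 / β)) ^ β = (β - 1) * (μ * α ^ β) := by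
    rw [Real.mul_rpow hα.le (by positivity), ← Real.rpow_mul (by positivity),
      one_div_mul_cancel (by linarith), Real.rpow_one]
    ring
  generalize α * (μ * (β - 1)) ^ (1 / β) = s at hs hpow ⊢
  generalize μ * α ^ β = C at hC hpow ⊢
  generalize k * β = c at hc ⊢
  refine ⟨?_, ?_, ?_, ?_⟩
  · refine strictMonoOn_of_deriv_pos (convex_Ioc 0 s) (fun t ht => ?_) (fun t ht => ?_)
    · exact (hasDerivAt_rpow_sub_one_div_rpow_add hC ht.1).continuousAt.continuousWithinAt
    · rw [interior_Ioc] at ht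
      have ht0 : 0 < t := ht.1
      rw [(hasDerivAt_rpow_sub_one_div_rpow_add hC ht0).deriv]
      have hlt : 0 < (β - 1) * C - t ^ β := by
        rw [← hpow, sub_pos]
        exact Real.rpow_lt_rpow ht0.le ht.2 (by linarith)
      positivity
  · refine strictAntiOn_of_deriv_neg (convex_Ici s) (fun t ht => ?_) (fun t ht => ?_)
    · exact (hasDerivAt_rpow_sub_one_div_rpow_add hC
        (hs.trans_le ht)).continuousAt.continuousWithinAt
    · rw [interior_Ici] at ht
      have ht0 : 0 < t := hs.trans ht
      rw [(hasDerivAt_rpow_sub_one_div_rpow_add hC ht0).deriv]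
      have hlt : (β - 1) * C - t ^ β < 0 := by
        rw [← hpow, sub_neg]
        exact Real.rpow_lt_rpow hs.le ht (by linarith)
      exact div_neg_of_neg_of_pos (mul_neg_of_pos_of_neg (by positivity) hlt) (by positivity)
  · have hnum : ContinuousAt (fun t : ℝ => c * t ^ (β - 1)) 0 :=
      (Real.continuousAt_rpow_const 0 (β - 1) (Or.inr hβ'.le)).const_mul c
    have hden : ContinuousAt (fun t : ℝ => t ^ β + C) 0 :=
      (Real.continuousAt_rpow_const 0 β (Or.inr (by linarith))).add_const C
    have h := (hnum.div hden (by positivity)).tendsto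
    simp only [Pi.div_apply, Real.zero_rpow hβ'.ne', mul_zero, zero_div] at h
    exact h.mono_left nhdsWithin_le_nhds
  · have hlim : Filter.Tendsto (fun t : ℝ => c / t) Filter.atTop (nhds 0) :=
      tendsto_const_nhds.div_atTop Filter.tendsto_id
    refine tendsto_of_tendsto_of_tendsto_of_le_of_le' tendsto_const_nhds hlim ?_ ?_
    · filter_upwards [Filter.eventually_gt_atTop 0] with t ht
      positivity
    · filter_upwards [Filter.eventually_gt_atTop 0] with t ht
      rw [div_le_div_iff₀ (by positivity) ht, mul_assoc, ← Real.rpow_add_one ht.ne',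
        sub_add_cancel]
      gcongr
      linarith
end

section
/- Let n ≥ r ≥ 1, k > 0, λ > 0, β_W > 0, and let x₁, …, x_r > 0 be given (the Type II censored sample from the baseline), and set t_i = λ x_i^{1/β_W} for i = 1, …, r. For data y = (y₁, …, y_r) and parameters b, l > 0, with Λ_i = (y_i/l)^b, define the Burr-XII Type II score functions U₁(b, l; y) = (k+1) Σ_{i=1}^r Λ_i ln Λ_i/(Λ_i + 1) − r − Σ_{i=1}^r ln Λ_i + k(n−r) Λ_r ln Λ_r/(Λ_r + 1) and U₂(b, l; y) = (k+1) Σ_{i=1}^r Λ_i/(Λ_i + 1) + k(n−r) Λ_r/(Λ_r + 1) − r. Then for all b, l > 0 and j ∈ {1, 2}, U_j(b, l; t) = U_j(b/β_W, (l/λ)^{β_W}; x). In particular, (b, l) solves the score equations U₁ = U₂ = 0 for the data t if and only if (b/β_W, (l/λ)^{β_W}) solves them for the data x; hence if maximum likelihood estimates are characterized by these score equations, β̂_W(t)/β_W = β̂_W(x) and (λ̂(t)/λ)^{β_W} = λ̂(x), so that β̂_W/β_W is a pivotal quantity for the Burr-XII distribution under Type II censoring. -/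
/-- Burr-XII Type II score function with respect to the shape parameter `b`, for a Type II
censored sample `y` of `r + 1` ordered failures out of `n` units, with `Λ_i = (y_i / l)^b`. -/
noncomputable def burrScore₁ (n r : ℕ) (k b l : ℝ) (y : Fin (r + 1) → ℝ) : ℝ :=
  (k + 1) * ∑ i : Fin (r + 1),
      ((y i / l) ^ b * Real.log ((y i / l) ^ b) / ((y i / l) ^ b + 1))
    - (r + 1 : ℝ) - ∑ i : Fin (r + 1), Real.log ((y i / l) ^ b)
    + k * ((n : ℝ) - (r + 1 : ℝ)) *
      ((y (Fin.last r) / l) ^ b * Real.log ((y (Fin.last r) / l) ^ b) /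
        ((y (Fin.last r) / l) ^ b + 1))

/-- Burr-XII Type II score function with respect to the scale parameter `l`. -/
noncomputable def burrScore₂ (n r : ℕ) (k b l : ℝ) (y : Fin (r + 1) → ℝ) : ℝ :=
  (k + 1) * ∑ i : Fin (r + 1), ((y i / l) ^ b / ((y i / l) ^ b + 1))
    + k * ((n : ℝ) - (r + 1 : ℝ)) *
      ((y (Fin.last r) / l) ^ b / ((y (Fin.last r) / l) ^ b + 1))
    - (r + 1 : ℝ)

/-- The standardized quantity `(y / l) ^ b` is unchanged when `y = c * x ^ (1 / β)` is replaced by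
`x`, `b` by `b / β` and `l` by `(l / c) ^ β`. -/
theorem scaled_rpow_div_rpow {x c β l : ℝ} (b : ℝ) (hx : 0 ≤ x) (hc : 0 < c) (hβ : β ≠ 0)
    (hl : 0 ≤ l) :
    (c * x ^ (1 / β) / l) ^ b = (x / (l / c) ^ β) ^ (b / β) := by
  have hx' : 0 ≤ x ^ (1 / β) := Real.rpow_nonneg hx _
  have hlc : 0 ≤ l / c := div_nonneg hl hc.le
  have hxβ : x = (x ^ (1 / β)) ^ β := by
    rw [← Real.rpow_mul hx, one_div_mul_cancel hβ, Real.rpow_one]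
  have hscale : c * x ^ (1 / β) / l = x ^ (1 / β) / (l / c) := by
    rw [div_div_eq_mul_div, mul_comm]
  conv_rhs => rw [hxβ]
  rw [hscale, ← Real.div_rpow hx' hlc, ← Real.rpow_mul (div_nonneg hx' hlc), mul_div_cancel₀ b hβ]

/-- Equivariance of the Burr-XII Type II score equations under the
transformation `t_i = λ x_i^(1/β_W)`: the score functions for the data `t` at `(b, l)` equal
those for the baseline data `x` at `(b/β_W, (l/λ)^β_W)`; hence `(b, l)` solves the score
equations for `t` iff `(b/β_W, (l/λ)^β_W)` solves them for `x`, and if the ML estimates are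
characterized by the score equations then `β̂_W(t)/β_W = β̂_W(x)` and `(λ̂(t)/λ)^β_W = λ̂(x)`,
so `β̂_W/β_W` is pivotal under Type II censoring. -/
theorem burrXII_score_equivariance_pivotal (n r : ℕ) (hnr : r + 1 ≤ n)
    (k lam betaW : ℝ) (hk : 0 < k) (hlam : 0 < lam) (hbetaW : 0 < betaW)
    (x : Fin (r + 1) → ℝ) (hx : ∀ i, 0 < x i)
    (t : Fin (r + 1) → ℝ) (ht : ∀ i, t i = lam * x i ^ (1 / betaW)) :
    (∀ b l : ℝ, 0 < b → 0 < l →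
      burrScore₁ n r k b l t = burrScore₁ n r k (b / betaW) ((l / lam) ^ betaW) x ∧
      burrScore₂ n r k b l t = burrScore₂ n r k (b / betaW) ((l / lam) ^ betaW) x) ∧
    (∀ b l : ℝ, 0 < b → 0 < l →
      ((burrScore₁ n r k b l t = 0 ∧ burrScore₂ n r k b l t = 0) ↔
        (burrScore₁ n r k (b / betaW) ((l / lam) ^ betaW) x = 0 ∧
          burrScore₂ n r k (b / betaW) ((l / lam) ^ betaW) x = 0))) ∧
    (∀ bt lt bx lx : ℝ, 0 < bt → 0 < lt → 0 < bx → 0 < lx →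
      (burrScore₁ n r k bt lt t = 0 ∧ burrScore₂ n r k bt lt t = 0) →
      (burrScore₁ n r k bx lx x = 0 ∧ burrScore₂ n r k bx lx x = 0) →
      (∀ b l : ℝ, 0 < b → 0 < l →
        burrScore₁ n r k b l x = 0 → burrScore₂ n r k b l x = 0 → b = bx ∧ l = lx) →
      bt / betaW = bx ∧ (lt / lam) ^ betaW = lx) := by
  have hscore : ∀ b l : ℝ, 0 < b → 0 < l →
      burrScore₁ n r k b l t = burrScore₁ n r k (b / betaW) ((l / lam) ^ betaW) x ∧
      burrScore₂ n r k b l t = burrScore₂ n r k (b / betaW) ((l / lam) ^ betaW) x := by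
    intro b l _ hl
    have hΛ : ∀ i, (t i / l) ^ b = (x i / (l / lam) ^ betaW) ^ (b / betaW) := fun i => by
      rw [ht i, scaled_rpow_div_rpow b (hx i).le hlam hbetaW.ne' hl.le]
    simp only [burrScore₁, burrScore₂, hΛ, and_self]
  refine ⟨hscore, fun b l hb hl => ?_, ?_⟩
  · rw [(hscore b l hb hl).1, (hscore b l hb hl).2]
  · intro bt lt bx lx hbt hlt _ _ hsol _ huniq
    obtain ⟨h₁, h₂⟩ := hscore bt lt hbt hlt
    exact huniq _ _ (div_pos hbt hbetaW) (Real.rpow_pos_of_pos (div_pos hlt hlam) _)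
      (h₁ ▸ hsol.1) (h₂ ▸ hsol.2)
end

section
/- Let n ≥ r ≥ 1, α > 0, β > 0, and let x₁, …, x_r > 0 be given (the Type II censored sample from the baseline), and set t_i = α x_i^{1/β} for i = 1, …, r. For data y = (y₁, …, y_r) and parameters b, a > 0, define the Weibull Type II score functions V₁(b, a; y) = Σ_{i=1}^r (y_i/a)^b + (n−r)(y_r/a)^b − r and V₂(b, a; y) = r/b + Σ_{i=1}^r ln(y_i/a) − Σ_{i=1}^r (y_i/a)^b ln(y_i/a) − (n−r)(y_r/a)^b ln(y_r/a). Then for all b, a > 0, V₁(b, a; t) = V₁(b/β, (a/α)^β; x) and V₂(b, a; t) = (1/β) V₂(b/β, (a/α)^β; x). In particular, (b, a) solves the score equations V₁ = V₂ = 0 for the data t if and only if (b/β, (a/α)^β) solves them for the data x; hence if maximum likelihood estimates are characterized by these score equations, β̂(t)/β = β̂(x), so that β̂/β is a pivotal quantity for the Weibull distribution under Type II censoring. -/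
/-- Weibull Type II score function with respect to the scale parameter `a`, for a Type II
censored sample `y` of `r + 1` ordered failures out of `n` units. -/
noncomputable def weibullScore₁ (n r : ℕ) (b a : ℝ) (y : Fin (r + 1) → ℝ) : ℝ :=
  (∑ i : Fin (r + 1), (y i / a) ^ b)
    + ((n : ℝ) - (r + 1 : ℝ)) * (y (Fin.last r) / a) ^ b - (r + 1 : ℝ)

/-- Weibull Type II score function with respect to the shape parameter `b`. -/
noncomputable def weibullScore₂ (n r : ℕ) (b a : ℝ) (y : Fin (r + 1) → ℝ) : ℝ :=
  (r + 1 : ℝ) / b + ∑ i : Fin (r + 1), Real.log (y i / a)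
    - ∑ i : Fin (r + 1), (y i / a) ^ b * Real.log (y i / a)
    - ((n : ℝ) - (r + 1 : ℝ)) * (y (Fin.last r) / a) ^ b * Real.log (y (Fin.last r) / a)

lemma weibull_log_rescale {alpha beta a x : ℝ} (halpha : 0 < alpha) (hbeta : 0 < beta)
    (ha : 0 < a) (hx : 0 < x) :
    Real.log (alpha * x ^ (1 / beta) / a)
      = (1 / beta) * Real.log (x / (a / alpha) ^ beta) := by
  rw [Real.log_div (by positivity) ha.ne', Real.log_mul halpha.ne' (by positivity),
    Real.log_rpow hx, Real.log_div hx.ne' (by positivity), Real.log_rpow (by positivity),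
    Real.log_div ha.ne' halpha.ne']
  field_simp
  ring

lemma weibull_rpow_rescale {alpha beta a x : ℝ} (halpha : 0 < alpha) (hbeta : 0 < beta)
    (ha : 0 < a) (hx : 0 < x) (b : ℝ) :
    (alpha * x ^ (1 / beta) / a) ^ b = (x / (a / alpha) ^ beta) ^ (b / beta) := by
  have ht : 0 < alpha * x ^ (1 / beta) / a := by positivity
  have hz : 0 < x / (a / alpha) ^ beta := by positivity
  rw [Real.rpow_def_of_pos ht, Real.rpow_def_of_pos hz,
    weibull_log_rescale halpha hbeta ha hx]
  congr 1
  ring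

lemma weibullScore₁_rescale (n r : ℕ) {alpha beta a : ℝ} (halpha : 0 < alpha)
    (hbeta : 0 < beta) (ha : 0 < a) (b : ℝ) {x : Fin (r + 1) → ℝ} (hx : ∀ i, 0 < x i) :
    weibullScore₁ n r b a (fun i => alpha * x i ^ (1 / beta))
      = weibullScore₁ n r (b / beta) ((a / alpha) ^ beta) x := by
  simp only [weibullScore₁, weibull_rpow_rescale halpha hbeta ha (hx _)]

lemma weibullScore₂_rescale (n r : ℕ) {alpha beta a : ℝ} (halpha : 0 < alpha)
    (hbeta : 0 < beta) (ha : 0 < a) (b : ℝ) {x : Fin (r + 1) → ℝ} (hx : ∀ i, 0 < x i) :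
    weibullScore₂ n r b a (fun i => alpha * x i ^ (1 / beta))
      = (1 / beta) * weibullScore₂ n r (b / beta) ((a / alpha) ^ beta) x := by
  simp only [weibullScore₂, weibull_rpow_rescale halpha hbeta ha (hx _),
    weibull_log_rescale halpha hbeta ha (hx _), mul_left_comm _ (1 / beta), ← Finset.mul_sum]
  field_simp

/-- Equivariance of the Weibull Type II score equations under the
transformation `t_i = α x_i^(1/β)`: `V₁(b, a; t) = V₁(b/β, (a/α)^β; x)` and
`V₂(b, a; t) = (1/β) V₂(b/β, (a/α)^β; x)`; hence `(b, a)` solves the score equations for `t`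
iff `(b/β, (a/α)^β)` solves them for `x`, and if ML estimates are characterized by the score
equations then `β̂(t)/β = β̂(x)`, so `β̂/β` is pivotal for the Weibull distribution under
Type II censoring. -/
theorem weibull_score_equivariance_pivotal (n r : ℕ) (hnr : r + 1 ≤ n)
    (alpha beta : ℝ) (halpha : 0 < alpha) (hbeta : 0 < beta)
    (x : Fin (r + 1) → ℝ) (hx : ∀ i, 0 < x i)
    (t : Fin (r + 1) → ℝ) (ht : ∀ i, t i = alpha * x i ^ (1 / beta)) :
    (∀ b a : ℝ, 0 < b → 0 < a →
      weibullScore₁ n r b a t = weibullScore₁ n r (b / beta) ((a / alpha) ^ beta) x ∧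
      weibullScore₂ n r b a t
        = (1 / beta) * weibullScore₂ n r (b / beta) ((a / alpha) ^ beta) x) ∧
    (∀ b a : ℝ, 0 < b → 0 < a →
      ((weibullScore₁ n r b a t = 0 ∧ weibullScore₂ n r b a t = 0) ↔
        (weibullScore₁ n r (b / beta) ((a / alpha) ^ beta) x = 0 ∧
          weibullScore₂ n r (b / beta) ((a / alpha) ^ beta) x = 0))) ∧
    (∀ bt at' bx ax : ℝ, 0 < bt → 0 < at' → 0 < bx → 0 < ax →
      (weibullScore₁ n r bt at' t = 0 ∧ weibullScore₂ n r bt at' t = 0) →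
      (weibullScore₁ n r bx ax x = 0 ∧ weibullScore₂ n r bx ax x = 0) →
      (∀ b a : ℝ, 0 < b → 0 < a →
        weibullScore₁ n r b a x = 0 → weibullScore₂ n r b a x = 0 → b = bx ∧ a = ax) →
      bt / beta = bx) := by
  obtain rfl : t = fun i => alpha * x i ^ (1 / beta) := funext ht
  have hscore : ∀ b a : ℝ, 0 < a →
      ((weibullScore₁ n r b a (fun i => alpha * x i ^ (1 / beta)) = 0 ∧
          weibullScore₂ n r b a (fun i => alpha * x i ^ (1 / beta)) = 0) ↔
        (weibullScore₁ n r (b / beta) ((a / alpha) ^ beta) x = 0 ∧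
          weibullScore₂ n r (b / beta) ((a / alpha) ^ beta) x = 0)) := by
    intro b a ha
    rw [weibullScore₁_rescale n r halpha hbeta ha b hx,
      weibullScore₂_rescale n r halpha hbeta ha b hx,
      mul_eq_zero_iff_left (one_div_pos.mpr hbeta).ne']
  refine ⟨fun b a _ ha => ⟨weibullScore₁_rescale n r halpha hbeta ha b hx,
    weibullScore₂_rescale n r halpha hbeta ha b hx⟩, fun b a _ ha => hscore b a ha, ?_⟩
  intro bt a bx ax hbt ha _ _ hsolt _ huniq
  obtain ⟨h₁, h₂⟩ := (hscore bt a ha).mp hsolt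
  exact (huniq _ _ (by positivity) (by positivity) h₁ h₂).1
end
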